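/- Let G be a K_4-free flat graph (every edge lies in at most two triangles) with no isolated edges, such that for every vertex v the induced neighborhood G[N(v)] is either a path with at least 2 edges or a cycle of length at least 4. Then the derivative of the clique polynomial C(G,x) = 1 + n x + m x^2 + t x^3 satisfies C'(G, -1/2) ≤ 0. -/

import Mathlib

open scoped Classical
open Polynomial

/-- The number of `i`-cliques of a finite simple graph. -/
noncomputable def cliqueCount {V : Type*} [Fintype V] (G : SimpleGraph V) (i : ℕ) : ℕ :=
  (G.cliqueFinset i).card

/-- The clique polynomial `C(G,x) = ∑ᵢ cᵢ(G) xⁱ` of a finite simple graph. -/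
noncomputable def cliquePoly {V : Type*} [Fintype V] (G : SimpleGraph V) : Polynomial ℝ :=
  ∑ i ∈ Finset.range (Fintype.card V + 1), (cliqueCount G i : ℝ) • Polynomial.X ^ i

/-- A graph is flat if every edge lies in at most two triangles. -/
def IsFlat {V : Type*} [Fintype V] (G : SimpleGraph V) : Prop :=
  ∀ u v : V, G.Adj u v → (G.neighborFinset u ∩ G.neighborFinset v).card ≤ 2

/-- A graph has no isolated edges if the endpoints of every edge have a common neighbor. -/
def NoIsolatedEdges {V : Type*} (G : SimpleGraph V) : Prop :=
  ∀ u v : V, G.Adj u v → ∃ w : V, G.Adj u w ∧ G.Adj v w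


lemma aux_count {V : Type*} [Fintype V] (G : SimpleGraph V) (i : ℕ) :
    ∑ v : V, ((G.cliqueFinset i).filter (fun s => v ∈ s)).card = cliqueCount G i * i := by
  have h := Finset.sum_card_bipartiteAbove_eq_sum_card_bipartiteBelow
    (s := (Finset.univ : Finset V)) (t := G.cliqueFinset i) (fun v s => v ∈ s)
  simp only [Finset.bipartiteAbove, Finset.bipartiteBelow] at h
  rw [h, cliqueCount]
  apply Finset.sum_const_nat
  intro s hs
  rw [SimpleGraph.mem_cliqueFinset_iff] at hs
  simpa using hs.card_eq

lemma aux_tri {V : Type*} [Fintype V] (G : SimpleGraph V) (v : V) {n k : ℕ}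
    (H : SimpleGraph (Fin n)) (φ : G.induce (G.neighborSet v) ≃g H)
    (f g : Fin k → Fin n)
    (hfg : ∀ a b, H.Adj a b → ∃ i, (a = f i ∧ b = g i) ∨ (b = f i ∧ a = g i)) :
    ((G.cliqueFinset 3).filter (fun s => v ∈ s)).card ≤ k := by
  have : (G.cliqueFinset 3).filter (fun s => v ∈ s) ⊆
      (Finset.univ : Finset (Fin k)).image
        (fun i => ({v, (φ.symm (f i)).1, (φ.symm (g i)).1} : Finset V)) := by
    intro s hs
    rw [Finset.mem_filter, SimpleGraph.mem_cliqueFinset_iff] at hs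
    obtain ⟨hs, hv⟩ := hs
    have key : ∃ a b, G.Adj v a ∧ G.Adj v b ∧ G.Adj a b ∧ s = {v, a, b} := by
      obtain ⟨x, y, z, hxy, hxz, hyz, rfl⟩ := SimpleGraph.is3Clique_iff.1 hs
      simp only [Finset.mem_insert, Finset.mem_singleton] at hv
      rcases hv with rfl | rfl | rfl
      · exact ⟨y, z, hxy, hxz, hyz, rfl⟩
      · exact ⟨x, z, hxy.symm, hyz, hxz, by grind⟩
      · exact ⟨x, y, hxz.symm, hyz.symm, hxy, by grind⟩
    obtain ⟨a, b, ha, hb, hab, rfl⟩ := key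
    have hadj : H.Adj (φ ⟨a, ha⟩) (φ ⟨b, hb⟩) := φ.map_adj_iff.2 hab
    obtain ⟨i, ⟨h1, h2⟩ | ⟨h1, h2⟩⟩ := hfg _ _ hadj
    · refine Finset.mem_image.2 ⟨i, Finset.mem_univ _, ?_⟩
      simp only [← h1, ← h2, RelIso.symm_apply_apply]
    · refine Finset.mem_image.2 ⟨i, Finset.mem_univ _, ?_⟩
      simp only [← h1, ← h2, RelIso.symm_apply_apply]
      grind
  calc _ ≤ _ := Finset.card_le_card this
    _ ≤ _ := Finset.card_image_le
    _ = k := by simp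

lemma aux_edge {V : Type*} [Fintype V] (G : SimpleGraph V) (v : V) {n : ℕ}
    (H : SimpleGraph (Fin n)) (φ : G.induce (G.neighborSet v) ≃g H) :
    n ≤ ((G.cliqueFinset 2).filter (fun s => v ∈ s)).card := by
  have hinj : Function.Injective (fun i : Fin n => ({v, (φ.symm i).1} : Finset V)) := by
    intro i j hij
    have hi : G.Adj v (φ.symm i).1 := (φ.symm i).2
    have hj : G.Adj v (φ.symm j).1 := (φ.symm j).2
    have h : (φ.symm i).1 = (φ.symm j).1 := by
      have h1 : (φ.symm i).1 ∈ ({v, (φ.symm j).1} : Finset V) := by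
        have : ({v, (φ.symm i).1} : Finset V) = {v, (φ.symm j).1} := hij
        rw [← this]; simp
      simp only [Finset.mem_insert, Finset.mem_singleton] at h1
      rcases h1 with h1 | h1
      · exact absurd h1.symm hi.ne
      · exact h1
    exact φ.symm.injective (Subtype.ext h)
  calc n = ((Finset.univ : Finset (Fin n)).image
        (fun i : Fin n => ({v, (φ.symm i).1} : Finset V))).card := by
        rw [Finset.card_image_of_injective _ hinj]; simp
    _ ≤ _ := by
      apply Finset.card_le_card
      intro s hs
      obtain ⟨i, -, rfl⟩ := Finset.mem_image.1 hs
      have hi : G.Adj v (φ.symm i).1 := (φ.symm i).2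
      rw [Finset.mem_filter, SimpleGraph.mem_cliqueFinset_iff, SimpleGraph.isNClique_iff]
      refine ⟨⟨?_, Finset.card_pair hi.ne⟩, by simp⟩
      simp [SimpleGraph.isClique_iff, Set.pairwise_insert, hi, hi.symm]

/-- For a `K₄`-free flat graph without isolated edges in which every induced neighborhood is a
path with at least two edges or a cycle of length at least four, `C'(G, -1/2) ≤ 0`. -/
theorem stmt_6 {V : Type*} [Fintype V] (G : SimpleGraph V)
    (h4 : G.CliqueFree 4) (hflat : IsFlat G) (hiso : NoIsolatedEdges G)
    (hnbr : ∀ v : V,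
      (∃ l : ℕ, 2 ≤ l ∧ Nonempty (G.induce (G.neighborSet v) ≃g SimpleGraph.pathGraph (l + 1))) ∨
      (∃ c : ℕ, 4 ≤ c ∧ Nonempty (G.induce (G.neighborSet v) ≃g SimpleGraph.cycleGraph c))) :
    (cliquePoly G).derivative.eval (-1/2 : ℝ) ≤ 0 := by
  have hloc : ∀ v : V, 4 + ((G.cliqueFinset 3).filter (fun s => v ∈ s)).card ≤
      2 * ((G.cliqueFinset 2).filter (fun s => v ∈ s)).card := by
    intro v
    rcases hnbr v with ⟨l, hl, ⟨φ⟩⟩ | ⟨c, hc, ⟨φ⟩⟩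
    · have h1 := aux_edge G v _ φ
      have h2 := aux_tri G v _ φ (fun i : Fin l => i.castSucc) (fun i => i.succ) (by
        intro a b hab
        rw [SimpleGraph.pathGraph_adj] at hab
        rcases hab with h | h
        · exact ⟨⟨a.1, by omega⟩, Or.inl ⟨Fin.ext rfl, Fin.ext h.symm⟩⟩
        · exact ⟨⟨b.1, by omega⟩, Or.inr ⟨Fin.ext rfl, Fin.ext h.symm⟩⟩)
      omega
    · obtain ⟨c, rfl⟩ : ∃ k, c = k + 2 := ⟨c - 2, by omega⟩
      have h1 := aux_edge G v _ φ
      have h2 := aux_tri G v _ φ (fun i : Fin (c+2) => i) (fun i => i + 1) (by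
        intro a b hab
        rw [SimpleGraph.cycleGraph_adj] at hab
        rcases hab with h | h
        · exact ⟨b, Or.inr ⟨rfl, by rw [← h]; abel⟩⟩
        · exact ⟨a, Or.inl ⟨rfl, by rw [← h]; abel⟩⟩)
      omega
  have hsum := Finset.sum_le_sum (fun v (_ : v ∈ (Finset.univ : Finset V)) => hloc v)
  rw [Finset.sum_add_distrib, ← Finset.mul_sum, aux_count, aux_count] at hsum
  simp only [Finset.sum_const, Finset.card_univ, smul_eq_mul] at hsum
  have h1 : cliqueCount G 1 ≤ Fintype.card V := by
    have : G.cliqueFinset 1 ⊆ (Finset.univ : Finset V).powersetCard 1 := by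
      intro s hs
      rw [SimpleGraph.mem_cliqueFinset_iff] at hs
      simp [Finset.mem_powersetCard, hs.card_eq]
    simpa [cliqueCount] using Finset.card_le_card this
  have hz4 : ∀ i, 4 ≤ i → cliqueCount G i = 0 := by
    intro i hi
    rw [cliqueCount, Finset.card_eq_zero, SimpleGraph.cliqueFinset_eq_empty_iff]
    exact h4.mono hi
  have hzN : ∀ i, Fintype.card V + 1 ≤ i → cliqueCount G i = 0 := by
    intro i hi
    rw [cliqueCount, Finset.card_eq_zero, SimpleGraph.cliqueFinset_eq_empty_iff]
    exact SimpleGraph.cliqueFree_of_card_lt (by omega)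
  have hpoly : cliquePoly G = ∑ i ∈ Finset.range 4, (cliqueCount G i : ℝ) • X ^ i := by
    have e1 : cliquePoly G = ∑ i ∈ Finset.range (Fintype.card V + 1 + 4),
        (cliqueCount G i : ℝ) • (X : ℝ[X]) ^ i := by
      refine Finset.sum_subset (Finset.range_mono (by omega)) ?_
      intro i _ hi
      rw [hzN i (by simpa using hi)]; simp
    rw [e1]
    symm
    refine Finset.sum_subset (Finset.range_mono (by omega)) ?_
    intro i _ hi
    rw [hz4 i (by simpa using hi)]; simp
  rw [hpoly]
  simp only [Finset.sum_range_succ, Finset.sum_range_zero, derivative_add, derivative_smul,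
    eval_add, eval_smul, derivative_X_pow, eval_mul, eval_pow, eval_X, smul_eq_mul]
  norm_num
  have h1' : (cliqueCount G 1 : ℝ) ≤ Fintype.card V := by exact_mod_cast h1
  have h2' : (Fintype.card V : ℝ) * 4 + cliqueCount G 3 * 3 ≤ 2 * (cliqueCount G 2 * 2) := by
    exact_mod_cast hsum
  linarith
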